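/- Let s ≥ 1/2, h>0 and f ∈ Γ_s^{∞,h}(ℝ^d). For ε>0 set f_ε(x) = e^{-ε|x|²} f(x). Then there exists h₁>0 (any h₁ sufficiently large depending only on h) such that for every r>0 one has ‖f - f_ε‖_{s,h₁,r} → 0 as ε → 0⁺. -/

import Mathlib

open MeasureTheory Real Complex Finset Filter

noncomputable section

/-- `ℝ^d` with the Euclidean norm. -/
abbrev E (d : ℕ) := EuclideanSpace ℝ (Fin d)

/-- The partial derivative in the coordinate direction `i`. -/
def pdi {d : ℕ} (i : Fin d) (f : E d → ℂ) : E d → ℂ :=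
  fun x => fderiv ℝ f x (EuclideanSpace.single i 1)

/-- The iterated partial derivative `∂^α` along a multi-index `α`. -/
def pdm {d : ℕ} (α : Fin d → ℕ) (f : E d → ℂ) : E d → ℂ :=
  List.foldr (fun i g => (pdi i)^[α i] g) f (List.finRange d)

/-- The multi-index factorial `α!`. -/
def mfact {d : ℕ} (α : Fin d → ℕ) : ℕ := ∏ i, Nat.factorial (α i)

/-- The multi-index length `|α|`. -/
def msize {d : ℕ} (α : Fin d → ℕ) : ℕ := ∑ i, α i

/-- Partial derivative in direction `i` of the first group of variables. -/
def pdi1 {d₁ d₂ : ℕ} (i : Fin d₁) (f : E d₁ × E d₂ → ℂ) : E d₁ × E d₂ → ℂ :=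
  fun x => fderiv ℝ f x (EuclideanSpace.single i 1, 0)

/-- Partial derivative in direction `i` of the second group of variables. -/
def pdi2 {d₁ d₂ : ℕ} (i : Fin d₂) (f : E d₁ × E d₂ → ℂ) : E d₁ × E d₂ → ℂ :=
  fun x => fderiv ℝ f x (0, EuclideanSpace.single i 1)

/-- The iterated partial derivative `∂_{x₁}^{α₁} ∂_{x₂}^{α₂}`. -/
def pdm2 {d₁ d₂ : ℕ} (α₁ : Fin d₁ → ℕ) (α₂ : Fin d₂ → ℕ) (f : E d₁ × E d₂ → ℂ) :
    E d₁ × E d₂ → ℂ :=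
  List.foldr (fun i g => (pdi1 i)^[α₁ i] g)
    (List.foldr (fun i g => (pdi2 i)^[α₂ i] g) f (List.finRange d₂)) (List.finRange d₁)

/-- The iterated partial derivative along a list of coordinate directions. -/
def wordDeriv {d : ℕ} (w : List (Fin d)) (f : E d → ℂ) : E d → ℂ := w.foldr pdi f

section WordDeriv

variable {d : ℕ}

lemma wordDeriv_append (v w : List (Fin d)) (f : E d → ℂ) :
    wordDeriv (v ++ w) f = wordDeriv v (wordDeriv w f) := by
  simp [wordDeriv]

lemma ContDiff.pdi {f : E d → ℂ} (hf : ContDiff ℝ (⊤ : ℕ∞) f) (i : Fin d) :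
    ContDiff ℝ (⊤ : ℕ∞) (pdi i f) := by
  have h : ContDiff ℝ (⊤ : ℕ∞) (fderiv ℝ f) := hf.fderiv_right (by exact_mod_cast le_top)
  exact h.clm_apply contDiff_const

lemma ContDiff.wordDeriv {f : E d → ℂ} (hf : ContDiff ℝ (⊤ : ℕ∞) f) (w : List (Fin d)) :
    ContDiff ℝ (⊤ : ℕ∞) (wordDeriv w f) := by
  induction w with
  | nil => exact hf
  | cons i w ih => exact ih.pdi i

lemma differentiable_of_smooth {f : E d → ℂ} (hf : ContDiff ℝ (⊤ : ℕ∞) f) :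
    Differentiable ℝ f := hf.differentiable (by simp)

lemma pdi_comm {f : E d → ℂ} (hf : ContDiff ℝ (⊤ : ℕ∞) f) (i j : Fin d) :
    pdi i (pdi j f) = pdi j (pdi i f) := by
  have h : ContDiff ℝ (⊤ : ℕ∞) (fderiv ℝ f) := hf.fderiv_right (by exact_mod_cast le_top)
  have key (a b : Fin d) (x : E d) : pdi a (pdi b f) x =
      fderiv ℝ (fderiv ℝ f) x (EuclideanSpace.single a 1) (EuclideanSpace.single b 1) := by
    have hd : DifferentiableAt ℝ (fderiv ℝ f) x := h.differentiable (by simp) x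
    have h₁ := (hd.hasFDerivAt.clm_apply
      (hasFDerivAt_const (EuclideanSpace.single b (1 : ℝ)) x)).fderiv
    refine (congrArg (fun L => L (EuclideanSpace.single a 1)) h₁).trans ?_
    simp
  ext x
  rw [key, key]
  refine (hf.contDiffAt.isSymmSndFDerivAt ?_) _ _
  rw [minSmoothness_of_isRCLikeNormedField]
  exact WithTop.coe_le_coe.2 le_top

lemma wordDeriv_perm {f : E d → ℂ} (hf : ContDiff ℝ (⊤ : ℕ∞) f) {v w : List (Fin d)}
    (h : v.Perm w) : wordDeriv v f = wordDeriv w f := by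
  induction h with
  | nil => rfl
  | cons i _ ih => exact congrArg (pdi i) ih
  | swap i j l => exact pdi_comm (hf.wordDeriv l) j i
  | trans _ _ h₁ h₂ => exact h₁.trans h₂

lemma wordDeriv_replicate (n : ℕ) (i : Fin d) (f : E d → ℂ) :
    wordDeriv (List.replicate n i) f = (pdi i)^[n] f := by
  induction n with
  | zero => rfl
  | succ n ih => rw [Function.iterate_succ_apply', ← ih]; rfl

lemma pdm_eq_wordDeriv (α : Fin d → ℕ) (f : E d → ℂ) :
    pdm α f = wordDeriv ((List.finRange d).flatMap fun i => List.replicate (α i) i) f := by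
  unfold pdm
  induction List.finRange d with
  | nil => rfl
  | cons i l ih => rw [List.flatMap_cons, wordDeriv_append, List.foldr_cons, ih,
      wordDeriv_replicate]

lemma count_flatMap_replicate (α : Fin d → ℕ) (j : Fin d) :
    ((List.finRange d).flatMap fun i => List.replicate (α i) i).count j = α j := by
  rw [List.count_flatMap, ← Fin.sum_univ_def]
  simp [List.count_replicate]

lemma wordDeriv_eq_pdm {f : E d → ℂ} (hf : ContDiff ℝ (⊤ : ℕ∞) f) (w : List (Fin d)) :
    wordDeriv w f = pdm (fun i => w.count i) f := by
  rw [pdm_eq_wordDeriv]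
  refine wordDeriv_perm hf (List.perm_iff_count.2 fun j => ?_)
  rw [count_flatMap_replicate]

lemma msize_count (w : List (Fin d)) : msize (fun i => w.count i) = w.length := by
  induction w with
  | nil => simp [msize]
  | cons i w ih =>
    simp only [msize, List.count_cons, Finset.sum_add_distrib, List.length_cons] at ih ⊢
    simp [ih]

lemma exists_word (α : Fin d → ℕ) (f : E d → ℂ) :
    ∃ w : List (Fin d), (fun i => w.count i) = α ∧ pdm α f = wordDeriv w f :=
  ⟨_, funext (count_flatMap_replicate α), pdm_eq_wordDeriv α f⟩

lemma pdi_add {f g : E d → ℂ} (hf : ContDiff ℝ (⊤ : ℕ∞) f) (hg : ContDiff ℝ (⊤ : ℕ∞) g)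
    (i : Fin d) : pdi i (f + g) = pdi i f + pdi i g := by
  ext x
  simp [pdi, fderiv_add (differentiable_of_smooth hf x) (differentiable_of_smooth hg x)]

lemma wordDeriv_add {f g : E d → ℂ} (hf : ContDiff ℝ (⊤ : ℕ∞) f)
    (hg : ContDiff ℝ (⊤ : ℕ∞) g) (w : List (Fin d)) :
    wordDeriv w (f + g) = wordDeriv w f + wordDeriv w g := by
  induction w with
  | nil => rfl
  | cons i w ih => exact (congrArg (pdi i) ih).trans (pdi_add (hf.wordDeriv w) (hg.wordDeriv w) i)

lemma pdi_mul {f g : E d → ℂ} (hf : ContDiff ℝ (⊤ : ℕ∞) f) (hg : ContDiff ℝ (⊤ : ℕ∞) g)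
    (i : Fin d) : pdi i (f * g) = pdi i f * g + f * pdi i g := by
  ext x
  simp [pdi, fderiv_mul (differentiable_of_smooth hf x) (differentiable_of_smooth hg x)]
  ring

lemma mfact_pos (α : Fin d → ℕ) : 0 < mfact α := Finset.prod_pos fun _ _ => Nat.factorial_pos _

lemma mfact_mul_le (α β : Fin d → ℕ) : mfact α * mfact β ≤ mfact (α + β) := by
  unfold mfact
  rw [← Finset.prod_mul_distrib]
  exact Finset.prod_le_prod' fun i _ => Nat.le_of_dvd (Nat.factorial_pos _)
    (Nat.factorial_mul_factorial_dvd_factorial_add _ _)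

/-- A Leibniz rule for bounds of Gevrey type at a point. -/
lemma norm_wordDeriv_mul_le {u f : E d → ℂ} (hu : ContDiff ℝ (⊤ : ℕ∞) u)
    (hf : ContDiff ℝ (⊤ : ℕ∞) f) {x : E d} {a b A B s : ℝ} (hs : 0 ≤ s)
    (ha : 0 ≤ a) (hb : 0 ≤ b) (hA : 0 ≤ A) (hB : 0 ≤ B)
    (hua : ∀ w : List (Fin d),
      ‖wordDeriv w u x‖ ≤ A * a ^ w.length * (mfact (fun i => w.count i) : ℝ) ^ s)
    (hfb : ∀ w : List (Fin d),
      ‖wordDeriv w f x‖ ≤ B * b ^ w.length * (mfact (fun i => w.count i) : ℝ) ^ s)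
    (w p q : List (Fin d)) :
    ‖wordDeriv w (wordDeriv p u * wordDeriv q f) x‖ ≤
      A * B * (a + b) ^ w.length * a ^ p.length * b ^ q.length *
        (mfact (fun i => (w ++ p ++ q).count i) : ℝ) ^ s := by
  induction w using List.reverseRecOn generalizing p q with
  | nil =>
    have h : (mfact (fun i => p.count i) : ℝ) ^ s * (mfact (fun i => q.count i) : ℝ) ^ s ≤
        (mfact (fun i => (p ++ q).count i) : ℝ) ^ s := by
      rw [← Real.mul_rpow (by positivity) (by positivity)]
      refine Real.rpow_le_rpow (by positivity) ?_ hs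
      have := mfact_mul_le (fun i => p.count i) (fun i => q.count i)
      simp only [List.count_append]
      exact_mod_cast this
    calc ‖wordDeriv p u x * wordDeriv q f x‖
        ≤ (A * a ^ p.length * (mfact (fun i => p.count i) : ℝ) ^ s) *
          (B * b ^ q.length * (mfact (fun i => q.count i) : ℝ) ^ s) := by
          rw [norm_mul]
          exact mul_le_mul (hua p) (hfb q) (norm_nonneg _) (by positivity)
      _ = A * B * a ^ p.length * b ^ q.length * ((mfact (fun i => p.count i) : ℝ) ^ s *
          (mfact (fun i => q.count i) : ℝ) ^ s) := by ring
      _ ≤ A * B * a ^ p.length * b ^ q.length * (mfact (fun i => (p ++ q).count i) : ℝ) ^ s := by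
          gcongr
      _ = _ := by simp
  | append_singleton w i ih =>
    have e : wordDeriv (w ++ [i]) (wordDeriv p u * wordDeriv q f) =
        wordDeriv w (wordDeriv (i :: p) u * wordDeriv q f) +
          wordDeriv w (wordDeriv p u * wordDeriv (i :: q) f) := by
      rw [wordDeriv_append]
      exact (congrArg (wordDeriv w) (pdi_mul (hu.wordDeriv p) (hf.wordDeriv q) i)).trans
        (wordDeriv_add ((hu.wordDeriv (i :: p)).mul (hf.wordDeriv q))
          ((hu.wordDeriv p).mul (hf.wordDeriv (i :: q))) w)
    have c₁ : (fun j => (w ++ i :: p ++ q).count j) = fun j => (w ++ [i] ++ p ++ q).count j := by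
      simp
    have c₂ : (fun j => (w ++ p ++ i :: q).count j) = fun j => (w ++ [i] ++ p ++ q).count j := by
      funext j
      simp only [List.count_append, List.count_cons, List.count_nil]
      ring
    have h₁ := ih (i :: p) q
    have h₂ := ih p (i :: q)
    rw [c₁] at h₁
    rw [c₂] at h₂
    rw [e]
    refine (norm_add_le _ _).trans ((add_le_add h₁ h₂).trans_eq ?_)
    simp only [List.length_cons, List.length_append, List.length_nil]
    ring

end WordDeriv

/-- The `n`-th derivative of `t ↦ exp (-ε t²)`. -/
def gaussDeriv (ε : ℝ) : ℕ → ℝ → ℝ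
  | 0, t => Real.exp (-(ε * t ^ 2))
  | 1, t => -2 * ε * (t * Real.exp (-(ε * t ^ 2)))
  | n + 2, t => -2 * ε * (t * gaussDeriv ε (n + 1) t + (n + 1) * gaussDeriv ε n t)

lemma hasDerivAt_gaussDeriv (ε : ℝ) (n : ℕ) (t : ℝ) :
    HasDerivAt (gaussDeriv ε n) (gaussDeriv ε (n + 1) t) t := by
  induction n using Nat.twoStepInduction with
  | zero =>
    have h := (((hasDerivAt_id t).pow 2).const_mul ε).neg.exp
    refine (h.congr_deriv ?_).congr_of_eventuallyEq (.of_forall fun y => ?_)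
    · simp [gaussDeriv]; ring
    · simp [gaussDeriv]
  | one =>
    have h := (((hasDerivAt_id t).pow 2).const_mul ε).neg.exp
    have h' := ((hasDerivAt_id t).mul h).const_mul (-2 * ε)
    refine (h'.congr_deriv ?_).congr_of_eventuallyEq (.of_forall fun y => ?_)
    · simp [gaussDeriv, -mul_eq_mul_left_iff]; ring
    · simp [gaussDeriv]
  | more n h₀ h₁ =>
    have h' := (((hasDerivAt_id t).mul h₁).add (h₀.const_mul ((n : ℝ) + 1))).const_mul (-2 * ε)
    refine (h'.congr_deriv ?_).congr_of_eventuallyEq (.of_forall fun y => ?_)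
    · simp [gaussDeriv, -mul_eq_mul_left_iff]; ring
    · simp [gaussDeriv]

lemma abs_gaussDeriv_le_pow {ε : ℝ} (hε : 0 ≤ ε) (n : ℕ) (t : ℝ) :
    |gaussDeriv ε n t| ≤ (2 * √ε) ^ n * (√ε * |t| + √n) ^ n * Real.exp (-(ε * t ^ 2)) := by
  have hsq : √ε ^ 2 = ε := Real.sq_sqrt hε
  induction n using Nat.twoStepInduction with
  | zero => simp [gaussDeriv]
  | one =>
    have : |gaussDeriv ε 1 t| = 2 * √ε * (√ε * |t|) * Real.exp (-(ε * t ^ 2)) := by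
      simp only [gaussDeriv, abs_mul, abs_neg, abs_of_nonneg hε, Real.abs_exp]
      norm_num
      linear_combination (-2 * |t| * Real.exp (-(ε * t ^ 2))) * hsq
    rw [this]
    simp only [pow_one]
    gcongr
    simp
  | more n h₀ h₁ =>
    set G := Real.exp (-(ε * t ^ 2))
    set e := √ε
    have he : 0 ≤ e := Real.sqrt_nonneg _
    have hm : (√((n + 1 : ℕ) : ℝ)) ^ 2 = n + 1 := by rw [Real.sq_sqrt (by positivity)]; simp
    set m := √((n + 1 : ℕ) : ℝ)
    have hm0 : 0 ≤ m := Real.sqrt_nonneg _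
    have h₀' : |gaussDeriv ε n t| ≤ (2 * e) ^ n * (e * |t| + m) ^ n * G := by
      refine h₀.trans ?_
      gcongr
      exact Real.sqrt_le_sqrt (by simp)
    have hv : 0 ≤ e * |t| + m := by positivity
    have : |gaussDeriv ε (n + 2) t| ≤ (2 * e) ^ (n + 2) * (e * |t| + m) ^ (n + 2) * G := by
      calc |gaussDeriv ε (n + 2) t|
          ≤ 2 * ε * (|t| * |gaussDeriv ε (n + 1) t| + (n + 1) * |gaussDeriv ε n t|) := by
            simp only [gaussDeriv, abs_mul, abs_neg, abs_of_nonneg hε]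
            norm_num
            gcongr
            refine (abs_add_le _ _).trans_eq ?_
            rw [abs_mul, abs_mul, abs_of_nonneg (by positivity : (0 : ℝ) ≤ n + 1)]
        _ ≤ 2 * ε * (|t| * ((2 * e) ^ (n + 1) * (e * |t| + m) ^ (n + 1) * G) +
            (n + 1) * ((2 * e) ^ n * (e * |t| + m) ^ n * G)) := by gcongr
        _ = (2 * e) ^ n * (e * |t| + m) ^ n * G * e ^ 2 *
            (4 * (e * |t|) * (e * |t| + m) + 2 * m ^ 2) := by rw [hm, ← hsq]; ring
        _ ≤ (2 * e) ^ n * (e * |t| + m) ^ n * G * e ^ 2 * (4 * (e * |t| + m) ^ 2) := by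
            gcongr
            nlinarith [mul_nonneg (mul_nonneg he (abs_nonneg t)) hm0, sq_nonneg m]
        _ = _ := by ring
    refine this.trans ?_
    gcongr
    exact Real.sqrt_le_sqrt (by simp)

lemma abs_gaussDeriv_le {ε : ℝ} (hε : 0 ≤ ε) (n : ℕ) (t : ℝ) :
    |gaussDeriv ε n t| ≤ (√ε * (2 * Real.exp 1)) ^ n * √(n.factorial : ℝ) := by
  have hsq : √ε ^ 2 = ε := Real.sq_sqrt hε
  have hn : √(n : ℝ) ^ 2 = n := Real.sq_sqrt (by positivity)
  set v := √ε * |t| + √n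
  have hv : 0 ≤ v := by positivity
  have key : v ^ n * Real.exp (-(ε * t ^ 2)) ≤ Real.exp 1 ^ n * √(n.factorial : ℝ) := by
    refine (sq_le_sq₀ (by positivity) (by positivity)).1 ?_
    have h₁ : (v ^ 2) ^ n ≤ n.factorial * Real.exp (v ^ 2) := by
      have := Real.pow_div_factorial_le_exp (v ^ 2) (by positivity) n
      rwa [div_le_iff₀' (by positivity)] at this
    have h₂ : v ^ 2 ≤ 2 * (ε * t ^ 2) + 2 * n := by
      rw [← hn, ← hsq, ← sq_abs t]
      nlinarith [sq_nonneg (√ε * |t| - √n)]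
    calc (v ^ n * Real.exp (-(ε * t ^ 2))) ^ 2
        = (v ^ 2) ^ n * Real.exp (-(2 * (ε * t ^ 2))) := by
          rw [mul_pow, ← Real.exp_nat_mul]; ring_nf
      _ ≤ n.factorial * Real.exp (2 * (ε * t ^ 2) + 2 * n) * Real.exp (-(2 * (ε * t ^ 2))) := by
          gcongr
          exact h₁.trans (by gcongr)
      _ = (Real.exp 1 ^ n * √(n.factorial : ℝ)) ^ 2 := by
          rw [mul_pow, Real.sq_sqrt (by positivity), mul_assoc, ← Real.exp_add, ← Real.exp_nat_mul,
            ← Real.exp_nat_mul]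
          push_cast
          ring_nf
  refine (abs_gaussDeriv_le_pow hε n t).trans ?_
  calc (2 * √ε) ^ n * v ^ n * Real.exp (-(ε * t ^ 2))
      = (2 * √ε) ^ n * (v ^ n * Real.exp (-(ε * t ^ 2))) := by ring
    _ ≤ (2 * √ε) ^ n * (Real.exp 1 ^ n * √(n.factorial : ℝ)) := by gcongr
    _ = _ := by rw [← mul_assoc, ← mul_pow]; ring_nf

section Gaussian

variable {d : ℕ}

lemma pdi_prod_gaussDeriv (ε : ℝ) (α : Fin d → ℕ) (i : Fin d) (x : E d) :
    pdi i (fun x => ((∏ j, gaussDeriv ε (α j) (x j) : ℝ) : ℂ)) x =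
      ((∏ j, gaussDeriv ε (α j + if i = j then 1 else 0) (x j) : ℝ) : ℂ) := by
  have h₁ (j : Fin d) : HasFDerivAt (fun x : E d => gaussDeriv ε (α j) (x j))
      (gaussDeriv ε (α j + 1) (x j) • (EuclideanSpace.proj j : E d →L[ℝ] ℝ)) x :=
    (hasDerivAt_gaussDeriv ε (α j) (x j)).comp_hasFDerivAt x
      (EuclideanSpace.proj j : E d →L[ℝ] ℝ).hasFDerivAt
  have h₂ := HasFDerivAt.finsetProd (u := Finset.univ) fun j _ => h₁ j
  have h₃ := (Complex.ofRealCLM.hasFDerivAt).comp x h₂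
  have h₄ : pdi i (fun x => ((∏ j, gaussDeriv ε (α j) (x j) : ℝ) : ℂ)) x = _ :=
    congrArg (fun L => L (EuclideanSpace.single i 1)) h₃.fderiv
  rw [h₄]
  simp only [ContinuousLinearMap.comp_apply, Complex.ofRealCLM_apply]
  congr 1
  rw [_root_.sum_apply, Finset.sum_eq_single i]
  · rw [← Finset.prod_erase_mul _ _ (Finset.mem_univ i)]
    have h₅ : (EuclideanSpace.proj i : E d →L[ℝ] ℝ) (EuclideanSpace.single i 1) = 1 := by simp
    simp only [_root_.smul_apply, smul_eq_mul, h₅, if_true, mul_one]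
    congr 1
    refine Finset.prod_congr rfl fun j hj => ?_
    rw [if_neg (Finset.ne_of_mem_erase hj).symm, add_zero]
  · intro j _ hj
    simp [hj]
  · simp

lemma wordDeriv_gaussian (ε : ℝ) (w : List (Fin d)) :
    wordDeriv w (fun x => ((Real.exp (-(ε * ‖x‖ ^ 2)) : ℝ) : ℂ)) =
      fun x => ((∏ j, gaussDeriv ε (w.count j) (x j) : ℝ) : ℂ) := by
  induction w with
  | nil =>
    funext x
    simp only [wordDeriv, List.foldr_nil, List.count_nil, gaussDeriv, ← Real.exp_sum]
    rw [EuclideanSpace.norm_sq_eq, Finset.mul_sum, Finset.sum_neg_distrib]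
    simp
  | cons i w ih =>
    change pdi i (wordDeriv w _) = _
    rw [ih]
    funext x
    rw [pdi_prod_gaussDeriv]
    simp [List.count_cons]

lemma norm_wordDeriv_gaussian_le {ε : ℝ} (hε : 0 ≤ ε) (w : List (Fin d)) (x : E d) :
    ‖wordDeriv w (fun x => ((Real.exp (-(ε * ‖x‖ ^ 2)) : ℝ) : ℂ)) x‖ ≤
      (√ε * (2 * Real.exp 1)) ^ w.length * √(mfact (fun i => w.count i) : ℝ) := by
  rw [wordDeriv_gaussian, Complex.norm_real, Real.norm_eq_abs, Finset.abs_prod]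
  refine (Finset.prod_le_prod (fun _ _ => abs_nonneg _)
    fun j _ => abs_gaussDeriv_le hε _ _).trans_eq ?_
  rw [Finset.prod_mul_distrib, Finset.prod_pow_eq_pow_sum, ← msize_count w, mfact, Nat.cast_prod,
    Real.sqrt_prod _ fun _ _ => by positivity]
  rfl

lemma contDiff_gaussian (ε : ℝ) :
    ContDiff ℝ (⊤ : ℕ∞) (fun x : E d => ((Real.exp (-(ε * ‖x‖ ^ 2)) : ℝ) : ℂ)) :=
  Complex.ofRealCLM.contDiff.comp (contDiff_const.mul (contDiff_norm_sq ℝ)).neg.exp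

lemma wordDeriv_one_sub {g : E d → ℂ} {w : List (Fin d)} (hw : w ≠ []) :
    wordDeriv w (fun x => 1 - g x) = -wordDeriv w g := by
  induction w with
  | nil => exact absurd rfl hw
  | cons i w ih =>
    change pdi i (wordDeriv w _) = -pdi i (wordDeriv w _)
    by_cases h : w = []
    · subst h
      funext x
      simp [wordDeriv, pdi, fderiv_const_sub]
    · rw [ih h]
      funext x
      simp [pdi, fderiv_neg]

lemma norm_wordDeriv_one_sub_gaussian_le {ε s : ℝ} (hε : 0 ≤ ε) (hε₁ : ε ≤ 1) (hs : 1 / 2 ≤ s)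
    (w : List (Fin d)) (x : E d) :
    ‖wordDeriv w (fun x => 1 - ((Real.exp (-(ε * ‖x‖ ^ 2)) : ℝ) : ℂ)) x‖ ≤
      √ε * (1 + ‖x‖ ^ 2) * (2 * Real.exp 1) ^ w.length *
        (mfact (fun i => w.count i) : ℝ) ^ s := by
  have hq : √ε ≤ 1 := Real.sqrt_le_one.2 hε₁
  by_cases hw : w = []
  · subst hw
    have h₁ : ε ≤ √ε := by nlinarith [Real.sq_sqrt hε, Real.sqrt_nonneg ε]
    have h₂ := Real.add_one_le_exp (-(ε * ‖x‖ ^ 2))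
    have h₃ : Real.exp (-(ε * ‖x‖ ^ 2)) ≤ 1 := Real.exp_le_one_iff.2 (by
      have : 0 ≤ ε * ‖x‖ ^ 2 := by positivity
      linarith)
    have h₄ : ‖(1 : ℂ) - ((Real.exp (-(ε * ‖x‖ ^ 2)) : ℝ) : ℂ)‖ =
        1 - Real.exp (-(ε * ‖x‖ ^ 2)) := by
      rw [← Complex.ofReal_one, ← Complex.ofReal_sub, Complex.norm_real, Real.norm_eq_abs,
        abs_of_nonneg (by linarith)]
    simp only [wordDeriv, List.foldr_nil, h₄, List.count_nil, mfact, List.length_nil]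
    simp only [Nat.factorial_zero, Finset.prod_const_one, Nat.cast_one, Real.one_rpow, pow_zero,
      mul_one]
    nlinarith [mul_le_mul_of_nonneg_right h₁ (sq_nonneg ‖x‖), Real.sqrt_nonneg ε]
  · rw [wordDeriv_one_sub hw, Pi.neg_apply, norm_neg]
    refine (norm_wordDeriv_gaussian_le hε w x).trans ?_
    rw [mul_pow]
    have h₁ : √ε ^ w.length ≤ √ε * (1 + ‖x‖ ^ 2) :=
      (pow_le_of_le_one (Real.sqrt_nonneg _) hq (by simpa using hw)).trans
        (le_mul_of_one_le_right (Real.sqrt_nonneg _) (by nlinarith [sq_nonneg ‖x‖]))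
    have h₂ : √(mfact (fun i => w.count i) : ℝ) ≤ (mfact (fun i => w.count i) : ℝ) ^ s := by
      rw [Real.sqrt_eq_rpow]
      exact Real.rpow_le_rpow_of_exponent_le (by exact_mod_cast mfact_pos _) hs
    gcongr

end Gaussian

lemma exists_one_add_sq_mul_exp_le {s r : ℝ} (hs : 0 < s) (hr : 0 < r) :
    ∃ K : ℝ, 0 ≤ K ∧ ∀ t : ℝ, 0 ≤ t → (1 + t ^ 2) * Real.exp (-r * t ^ (1 / s)) ≤ K := by
  obtain ⟨N, hN⟩ := exists_nat_ge (2 * s)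
  refine ⟨2 + N.factorial / r ^ N, by positivity, fun t ht => ?_⟩
  set y := t ^ (1 / s) with hy
  have hy0 : 0 ≤ y := by positivity
  have hty : t ^ 2 = y ^ (2 * s) := by
    rw [hy, ← Real.rpow_mul ht, ← Real.rpow_natCast]
    congr 1
    field_simp
    simp
  have h₁ : t ^ 2 ≤ 1 + y ^ N := by
    rw [hty]
    rcases le_total y 1 with h | h
    · have := Real.rpow_le_one hy0 h (by positivity : 0 ≤ 2 * s)
      have := pow_nonneg hy0 N
      linarith
    · have := Real.rpow_le_rpow_of_exponent_le h hN
      rw [Real.rpow_natCast] at this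
      linarith
  have h₂ : y ^ N ≤ N.factorial / r ^ N * Real.exp (r * y) := by
    have := Real.pow_div_factorial_le_exp (r * y) (by positivity) N
    rw [div_le_iff₀ (by positivity), mul_pow] at this
    rw [div_mul_eq_mul_div, le_div_iff₀ (by positivity)]
    linarith
  have h₃ : 1 ≤ Real.exp (r * y) := Real.one_le_exp (by positivity)
  calc (1 + t ^ 2) * Real.exp (-r * y)
      ≤ ((2 + N.factorial / r ^ N) * Real.exp (r * y)) * Real.exp (-r * y) := by
        gcongr
        linarith
    _ = 2 + N.factorial / r ^ N := by
        rw [mul_assoc, ← Real.exp_add]; simp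

/-- if `f ∈ Γ_s^{∞,h}(ℝ^d)` and `f_ε(x) = e^{-ε|x|²} f(x)`, then
`‖f - f_ε‖_{s,h₁,r} → 0` as `ε → 0⁺`, for every sufficiently large `h₁` and every `r > 0`. -/
theorem stmt3 (d : ℕ) (hd : 0 < d) (s h : ℝ) (hs : 1/2 ≤ s) (hh : 0 < h)
    (f : E d → ℂ) (hf : ContDiff ℝ (⊤ : ℕ∞) f)
    (hfin : ∀ r > (0:ℝ), ∃ M : ℝ, ∀ (α : Fin d → ℕ) (x : E d),
      Real.exp (-r * ‖x‖ ^ (1/s)) * ‖pdm α f x‖ ≤ M * h ^ msize α * (mfact α : ℝ) ^ s) :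
    ∃ h₀ > (0:ℝ), ∀ h₁ ≥ h₀, ∀ r > (0:ℝ),
      Filter.Tendsto (fun ε : ℝ =>
          ⨆ (α : Fin d → ℕ) (x : E d), ENNReal.ofReal
            (Real.exp (-r * ‖x‖ ^ (1/s)) *
              ‖pdm α (fun y => f y - (Real.exp (-(ε * ‖y‖ ^ 2)) : ℂ) * f y) x‖ /
              (h₁ ^ msize α * (mfact α : ℝ) ^ s)))
        (nhdsWithin 0 (Set.Ioi 0)) (nhds (0 : ENNReal)) := by
  have hs0 : 0 < s := by linarith
  refine ⟨2 * Real.exp 1 + h, by positivity, fun h₁ hh₁ r hr => ?_⟩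
  have hpos : 0 < h₁ := lt_of_lt_of_le (by positivity) hh₁
  obtain ⟨M, hM⟩ := hfin (r / 2) (by positivity)
  obtain ⟨K, hK0, hK⟩ := exists_one_add_sq_mul_exp_le hs0 (half_pos hr)
  have key (ε : ℝ) (hε : 0 < ε) (hε₁ : ε ≤ 1) (α : Fin d → ℕ) (x : E d) :
      Real.exp (-r * ‖x‖ ^ (1/s)) *
        ‖pdm α (fun y => f y - (Real.exp (-(ε * ‖y‖ ^ 2)) : ℂ) * f y) x‖ /
          (h₁ ^ msize α * (mfact α : ℝ) ^ s) ≤ √ε * (K * |M|) := by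
    set u : E d → ℂ := fun y => 1 - ((Real.exp (-(ε * ‖y‖ ^ 2)) : ℝ) : ℂ) with hu_def
    have hu : ContDiff ℝ (⊤ : ℕ∞) u := contDiff_const.sub (contDiff_gaussian ε)
    have huf : (fun y => f y - (Real.exp (-(ε * ‖y‖ ^ 2)) : ℂ) * f y) = u * f := by
      funext y
      simp only [hu_def, Pi.mul_apply]
      ring
    have hmf : (0 : ℝ) < mfact α := by exact_mod_cast mfact_pos α
    rw [huf, div_le_iff₀ (by positivity)]
    obtain ⟨w, rfl, hw⟩ := exists_word α (u * f)
    rw [hw, msize_count]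
    set X := ‖x‖ ^ (1 / s)
    have hfb (v : List (Fin d)) : ‖wordDeriv v f x‖ ≤
        (|M| * Real.exp (r / 2 * X)) * h ^ v.length * (mfact (fun i => v.count i) : ℝ) ^ s := by
      have h₂ := hM (fun i => v.count i) x
      rw [← wordDeriv_eq_pdm hf, msize_count] at h₂
      calc ‖wordDeriv v f x‖
          = Real.exp (r / 2 * X) * (Real.exp (-(r / 2) * X) * ‖wordDeriv v f x‖) := by
            rw [← mul_assoc, ← Real.exp_add]; simp
        _ ≤ Real.exp (r / 2 * X) *
            (|M| * h ^ v.length * (mfact (fun i => v.count i) : ℝ) ^ s) := by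
            refine mul_le_mul_of_nonneg_left (h₂.trans ?_) (Real.exp_pos _).le
            gcongr
            exact le_abs_self M
        _ = _ := by ring
    have main := norm_wordDeriv_mul_le hu hf hs0.le (by positivity) hh.le (by positivity)
      (by positivity) (fun v => norm_wordDeriv_one_sub_gaussian_le hε.le hε₁ hs v x) hfb w [] []
    simp only [List.append_nil, List.length_nil, pow_zero, mul_one] at main
    change ‖wordDeriv w (u * f) x‖ ≤ _ at main
    calc Real.exp (-r * X) * ‖wordDeriv w (u * f) x‖
        ≤ Real.exp (-r * X) * (√ε * (1 + ‖x‖ ^ 2) * (|M| * Real.exp (r / 2 * X)) *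
          (2 * Real.exp 1 + h) ^ w.length * (mfact (fun i => w.count i) : ℝ) ^ s) := by gcongr
      _ = √ε * (((1 + ‖x‖ ^ 2) * Real.exp (-(r / 2) * X)) * |M|) *
          ((2 * Real.exp 1 + h) ^ w.length * (mfact (fun i => w.count i) : ℝ) ^ s) := by
          have : Real.exp (-(r / 2) * X) = Real.exp (-r * X) * Real.exp (r / 2 * X) := by
            rw [← Real.exp_add]; ring_nf
          rw [this]; ring
      _ ≤ √ε * (K * |M|) * (h₁ ^ w.length * (mfact (fun i => w.count i) : ℝ) ^ s) := by
          gcongr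
          exact hK _ (norm_nonneg x)
  have hlim : Tendsto (fun ε : ℝ => ENNReal.ofReal (√ε * (K * |M|)))
      (nhdsWithin 0 (Set.Ioi 0)) (nhds 0) := by
    have hc : Continuous fun ε : ℝ => ENNReal.ofReal (√ε * (K * |M|)) :=
      ENNReal.continuous_ofReal.comp (by fun_prop)
    have := (hc.tendsto 0).mono_left (nhdsWithin_le_nhds (s := Set.Ioi 0))
    simpa using this
  refine tendsto_of_tendsto_of_tendsto_of_le_of_le' tendsto_const_nhds hlim
    (.of_forall fun _ => zero_le) ?_
  filter_upwards [Ioc_mem_nhdsGT (zero_lt_one' ℝ)] with ε hε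
  exact iSup₂_le fun α x => ENNReal.ofReal_le_ofReal (key ε hε.1 hε.2 α x)

end
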